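/- Let λ, C ∈ ℂ and let u, W, S : ℝ² → ℂ be smooth functions such that S is nowhere zero, S² = −W_x² + λW² + C, and W_xx = 2uS + λW on ℝ². Then S_x = −2uW_x; and if in addition W satisfies the linearized equation W_t = W_xxx + 6u²W_x, then W_t = (λ + 2u²)W_x + 2u_x S holds on ℝ². (The generalized invariant manifold W_xx = 2uS + λW converts the linearization of mKdV in potential form into the t-part of the nonlinear Lax pair.) -/

import Mathlib

open Complex

/-- Partial derivative with respect to the first variable `x`. -/
noncomputable def dX (f : ℝ → ℝ → ℂ) : ℝ → ℝ → ℂ := fun x t => deriv (fun y => f y t) x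

/-- Partial derivative with respect to the second variable `t`. -/
noncomputable def dT (f : ℝ → ℝ → ℂ) : ℝ → ℝ → ℂ := fun x t => deriv (fun s => f x s) t

/-- `f` is a smooth function of `(x,t) ∈ ℝ²`. -/
def Smooth2 (f : ℝ → ℝ → ℂ) : Prop := ContDiff ℝ (⊤ : ℕ∞) (fun p : ℝ × ℝ => f p.1 p.2)

theorem Smooth2.contDiff_slice {f : ℝ → ℝ → ℂ} (hf : Smooth2 f) (t : ℝ) :
    ContDiff ℝ (⊤ : ℕ∞) (fun y => f y t) :=
  ContDiff.comp (g := fun p : ℝ × ℝ => f p.1 p.2) hf (contDiff_id.prodMk contDiff_const)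

theorem Smooth2.hasDerivAt_dX {f : ℝ → ℝ → ℂ} (hf : Smooth2 f) (x t : ℝ) :
    HasDerivAt (fun y => f y t) (dX f x t) x :=
  ((hf.contDiff_slice t).differentiable (by simp) x).hasDerivAt

theorem Smooth2.hasDerivAt_dX_dX {f : ℝ → ℝ → ℂ} (hf : Smooth2 f) (x t : ℝ) :
    HasDerivAt (fun y => dX f y t) (dX (dX f) x t) x :=
  ((contDiff_infty_iff_deriv.1 (hf.contDiff_slice t)).2.differentiable (by simp) x).hasDerivAt

/-- On the generalized invariant manifold `W_xx = 2uS + λW`, `S² = −W_x² + λW² + C`,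
one has `S_x = −2uW_x`; and the linearization `W_t = W_xxx + 6u²W_x` of mKdV in
potential form reduces to the `t`-part `W_t = (λ + 2u²)W_x + 2u_x S` of the
nonlinear Lax pair. -/
theorem mkdv_gim_converts_linearization
    (lam C : ℂ) (u W S : ℝ → ℝ → ℂ)
    (hu : Smooth2 u) (hW : Smooth2 W) (hS : Smooth2 S)
    (hSne : ∀ x t, S x t ≠ 0)
    (hS2 : ∀ x t, (S x t) ^ 2 = -(dX W x t) ^ 2 + lam * (W x t) ^ 2 + C)
    (hWxx : ∀ x t, dX (dX W) x t = 2 * u x t * S x t + lam * W x t) :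
    (∀ x t, dX S x t = -2 * u x t * dX W x t) ∧
    ((∀ x t, dT W x t = dX (dX (dX W)) x t + 6 * (u x t) ^ 2 * dX W x t) →
      ∀ x t, dT W x t = (lam + 2 * (u x t) ^ 2) * dX W x t + 2 * dX u x t * S x t) := by
  have hSx : ∀ x t, dX S x t = -2 * u x t * dX W x t := by
    intro x t
    have hl := (hS.hasDerivAt_dX x t).fun_pow 2
    have hr := (((hW.hasDerivAt_dX_dX x t).fun_pow 2).fun_neg.fun_add
      (((hW.hasDerivAt_dX x t).fun_pow 2).const_mul lam)).add_const C
    have heq := hl.unique (hr.congr_of_eventuallyEq (.of_forall fun y => hS2 y t))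
    rw [hWxx] at heq
    apply mul_left_cancel₀ (hSne x t)
    norm_num at heq
    linear_combination heq / 2
  refine ⟨hSx, fun hlin x t => ?_⟩
  have hWxxx : dX (dX (dX W)) x t =
      2 * dX u x t * S x t + 2 * u x t * dX S x t + lam * dX W x t := by
    have hr := (((hu.hasDerivAt_dX x t).const_mul 2).fun_mul (hS.hasDerivAt_dX x t)).fun_add
      ((hW.hasDerivAt_dX x t).const_mul lam)
    exact (hr.congr_of_eventuallyEq (.of_forall fun y => hWxx y t)).deriv
  rw [hlin, hWxxx, hSx]
  ring
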